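/- arXiv:2410.11686 — 4 statements merged into one kernel-verified Lean document; each statement's English description precedes it below -/
import Mathlib

section
/- Representer Theorem (feature-map form): Let w* be any minimizer over H of the regularized objective J(w) = L(⟪w, φ(X_1)⟫, …, ⟪w, φ(X_n)⟫) + ψ(‖w‖²), where L : ℝⁿ → ℝ is an arbitrary loss function and ψ : ℝ≥0 → ℝ is strictly monotonically increasing. Then w* lies in the linear span of {φ(X_1), …, φ(X_n)}; equivalently, there exist coefficients α_1, …, α_n ∈ ℝ such that the induced prediction function satisfies ⟪w*, φ(x)⟫ = Σ_{i=1}^n α_i k(X_i, x) for every x ∈ 𝒳. -/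
open scoped RealInnerProductSpace

/-- Representer Theorem (feature-map form). -/
theorem representer_theorem
    {𝒳 H : Type*} [NormedAddCommGroup H] [InnerProductSpace ℝ H]
    (φ : 𝒳 → H) {n : ℕ} (X : Fin n → 𝒳)
    (L : (Fin n → ℝ) → ℝ) (ψ : ℝ → ℝ) (hψ : StrictMonoOn ψ (Set.Ici 0))
    (J : H → ℝ) (hJ : ∀ w, J w = L (fun i => ⟪w, φ (X i)⟫) + ψ (‖w‖ ^ 2))
    (wstar : H) (hmin : ∀ w : H, J wstar ≤ J w) :
    wstar ∈ Submodule.span ℝ (Set.range fun i => φ (X i)) ∧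
      ∃ α : Fin n → ℝ, ∀ x : 𝒳, ⟪wstar, φ x⟫ = ∑ i, α i * ⟪φ (X i), φ x⟫ := by
  have hmem : wstar ∈ Submodule.span ℝ (Set.range fun i => φ (X i)) := by
    set K := Submodule.span ℝ (Set.range fun i => φ (X i))
    have : FiniteDimensional ℝ K := FiniteDimensional.span_of_finite ℝ (Set.finite_range _)
    have hinner (i : Fin n) : ⟪K.starProjection wstar, φ (X i)⟫ = ⟪wstar, φ (X i)⟫ := by
      have hi : φ (X i) ∈ K := Submodule.subset_span ⟨i, rfl⟩
      rw [K.inner_starProjection_left_eq_right, K.starProjection_eq_self_iff.mpr hi]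
    have hle := hmin (K.starProjection wstar)
    simp only [hJ, hinner, add_le_add_iff_left] at hle
    rw [hψ.le_iff_le (Set.mem_Ici.mpr (sq_nonneg _)) (Set.mem_Ici.mpr (sq_nonneg _)),
      sq_le_sq₀ (norm_nonneg _) (norm_nonneg _)] at hle
    exact (K.mem_iff_norm_starProjection wstar).mpr
      ((K.norm_starProjection_apply_le wstar).antisymm hle)
  refine ⟨hmem, ?_⟩
  obtain ⟨α, hα⟩ := (Submodule.mem_span_range_iff_exists_fun ℝ).mp hmem
  refine ⟨α, fun x => ?_⟩
  simp only [← hα, sum_inner, real_inner_smul_left]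
end

section
/- Projection step of the Representer Theorem: Suppose ψ : ℝ≥0 → ℝ is monotone nondecreasing and define J(w) = L(⟪w, φ(X_1)⟫, …, ⟪w, φ(X_n)⟫) + ψ(‖w‖²) for an arbitrary L : ℝⁿ → ℝ. For every w ∈ H, the orthogonal projection w̄ of w onto the (finite-dimensional, hence closed) linear span of {φ(X_1), …, φ(X_n)} satisfies ⟪w̄, φ(X_i)⟫ = ⟪w, φ(X_i)⟫ for all i and J(w̄) ≤ J(w). Consequently, the infimum of J over all of H equals the infimum of J over the span of {φ(X_1), …, φ(X_n)}. -/
open scoped RealInnerProductSpace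

/-- Infima of a real-valued function and of its precomposition with `g` agree, also when they are
unbounded below, provided every value dominates a value attained along `g`. -/
theorem iInf_eq_iInf_comp_of_forall_exists_le {α β : Type*} [Nonempty α] (f : α → ℝ) (g : β → α)
    (h : ∀ a, ∃ b, f (g b) ≤ f a) : ⨅ a, f a = ⨅ b, f (g b) := by
  have : Nonempty β := ⟨(h (Classical.arbitrary α)).choose⟩
  by_cases hg : BddBelow (Set.range fun b => f (g b))
  · have hf : BddBelow (Set.range f) := by
      obtain ⟨c, hc⟩ := hg
      refine ⟨c, ?_⟩
      rintro _ ⟨a, rfl⟩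
      obtain ⟨b, hb⟩ := h a
      exact (hc ⟨b, rfl⟩).trans hb
    refine le_antisymm (le_ciInf fun b => ciInf_le hf (g b)) (le_ciInf fun a => ?_)
    obtain ⟨b, hb⟩ := h a
    exact (ciInf_le hg b).trans hb
  · have hf : ¬ BddBelow (Set.range f) := fun hf =>
      hg (hf.mono (Set.range_comp_subset_range g f))
    rw [Real.iInf_of_not_bddBelow hf, Real.iInf_of_not_bddBelow hg]

/-- Projection step of the Representer Theorem. -/
theorem representer_projection_step
    {𝒳 H : Type*} [NormedAddCommGroup H] [InnerProductSpace ℝ H]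
    (φ : 𝒳 → H) {n : ℕ} (X : Fin n → 𝒳)
    (L : (Fin n → ℝ) → ℝ) (ψ : ℝ → ℝ) (hψ : MonotoneOn ψ (Set.Ici 0))
    (J : H → ℝ) (hJ : ∀ w, J w = L (fun i => ⟪w, φ (X i)⟫) + ψ (‖w‖ ^ 2))
    (S : Submodule ℝ H) (hS : S = Submodule.span ℝ (Set.range fun i => φ (X i))) :
    (∀ w wbar : H, wbar ∈ S → w - wbar ∈ Sᗮ →
      (∀ i, ⟪wbar, φ (X i)⟫ = ⟪w, φ (X i)⟫) ∧ J wbar ≤ J w) ∧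
      (⨅ w : H, J w) = ⨅ w : S, J (w : H) := by
  have key : ∀ w wbar : H, wbar ∈ S → w - wbar ∈ Sᗮ →
      (∀ i, ⟪wbar, φ (X i)⟫ = ⟪w, φ (X i)⟫) ∧ J wbar ≤ J w := by
    intro w wbar hmem horth
    have hinner : ∀ i, ⟪wbar, φ (X i)⟫ = ⟪w, φ (X i)⟫ := by
      intro i
      have hi : φ (X i) ∈ S := hS ▸ Submodule.subset_span ⟨i, rfl⟩
      have h := Submodule.inner_left_of_mem_orthogonal hi horth
      rw [inner_sub_left] at h
      linarith
    have hnorm : ‖wbar‖ ^ 2 ≤ ‖w‖ ^ 2 := by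
      have h := norm_add_sq_real wbar (w - wbar)
      rw [Submodule.inner_right_of_mem_orthogonal hmem horth, add_sub_cancel] at h
      nlinarith [sq_nonneg ‖w - wbar‖]
    refine ⟨hinner, ?_⟩
    rw [hJ, hJ, funext hinner]
    gcongr
    exact hψ (sq_nonneg ‖wbar‖) (sq_nonneg ‖w‖) hnorm
  refine ⟨key, ?_⟩
  have : FiniteDimensional ℝ S := hS ▸ FiniteDimensional.span_of_finite ℝ (Set.finite_range _)
  exact iInf_eq_iInf_comp_of_forall_exists_le J ((↑) : S → H) fun w =>
    ⟨⟨S.starProjection w, S.starProjection_apply_mem w⟩,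
      (key w _ (S.starProjection_apply_mem w) (S.sub_starProjection_mem_orthogonal w)).2⟩
end

section
/- Kernel ridge regression in the Hilbert space has a unique minimizer of representer form: Let λ > 0 and Y ∈ ℝⁿ. The functional E(w) = Σ_{i=1}^n (Y_i − ⟪w, φ(X_i)⟫)² + λ‖w‖² attains a unique minimizer w* over H, and w* = Σ_{i=1}^n α*_i φ(X_i) where α* = (K + λ𝕀)^{-1} Y. -/
open scoped RealInnerProductSpace Matrix

open Matrix in
/-- The coefficients `(G + lam • 1)⁻¹ Y` solve the regularized linear system of a Gram matrix. -/
theorem gram_add_smul_one_inv_mulVec_apply {H ι : Type*} [NormedAddCommGroup H]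
    [InnerProductSpace ℝ H] [Fintype ι] [DecidableEq ι] (f : ι → H) {lam : ℝ} (hlam : 0 < lam)
    (Y : ι → ℝ) (i : ι) :
    ∑ j, ⟪f i, f j⟫ * ((gram ℝ f + lam • (1 : Matrix ι ι ℝ))⁻¹ *ᵥ Y) j
      + lam * ((gram ℝ f + lam • (1 : Matrix ι ι ℝ))⁻¹ *ᵥ Y) i = Y i := by
  have hpos : (gram ℝ f + lam • (1 : Matrix ι ι ℝ)).PosDef :=
    PosDef.posSemidef_add (posSemidef_gram ℝ f) (PosDef.one.smul hlam)
  have hsolve : (gram ℝ f + lam • (1 : Matrix ι ι ℝ)) *ᵥ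
      ((gram ℝ f + lam • (1 : Matrix ι ι ℝ))⁻¹ *ᵥ Y) = Y := by
    rw [mulVec_mulVec, mul_nonsing_inv _ ((isUnit_iff_isUnit_det _).mp hpos.isUnit), one_mulVec]
  have hi := congrFun hsolve i
  rw [add_mulVec, smul_mulVec, one_mulVec] at hi
  simpa only [Pi.add_apply, Pi.smul_apply, smul_eq_mul, mulVec, dotProduct, gram_apply] using hi

/-- Expansion of the regularized least squares functional around a point `∑ i, a i • f i` whose
residuals are `lam * a i`. -/
theorem regularized_least_squares_eq_add {H ι : Type*} [NormedAddCommGroup H]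
    [InnerProductSpace ℝ H] [Fintype ι] (f : ι → H) (lam : ℝ) (Y a : ι → ℝ) {u : H}
    (hu : u = ∑ i, a i • f i) (ha : ∀ i, Y i - ⟪u, f i⟫ = lam * a i) (w : H) :
    ∑ i, (Y i - ⟪w, f i⟫) ^ 2 + lam * ‖w‖ ^ 2 =
      (∑ i, (Y i - ⟪u, f i⟫) ^ 2 + lam * ‖u‖ ^ 2)
        + (∑ i, ⟪w - u, f i⟫ ^ 2 + lam * ‖w - u‖ ^ 2) := by
  have hcross : ⟪u, w - u⟫ = ∑ i, a i * ⟪w - u, f i⟫ := by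
    rw [real_inner_comm]
    nth_rewrite 2 [hu]
    simp only [inner_sum, real_inner_smul_right]
  have hnorm : ‖w‖ ^ 2 = ‖u‖ ^ 2 + 2 * ⟪u, w - u⟫ + ‖w - u‖ ^ 2 := by
    rw [← norm_add_sq_real, add_sub_cancel]
  have hsum : ∑ i, (Y i - ⟪w, f i⟫) ^ 2 = ∑ i, (Y i - ⟪u, f i⟫) ^ 2
      - 2 * lam * ∑ i, a i * ⟪w - u, f i⟫ + ∑ i, ⟪w - u, f i⟫ ^ 2 := by
    rw [Finset.mul_sum, ← Finset.sum_sub_distrib, ← Finset.sum_add_distrib]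
    refine Finset.sum_congr rfl fun i _ => ?_
    have hw : ⟪w, f i⟫ = ⟪u, f i⟫ + ⟪w - u, f i⟫ := by rw [← inner_add_left, add_sub_cancel]
    rw [hw]
    linear_combination (-2 * ⟪w - u, f i⟫) * ha i
  rw [hsum, hnorm, hcross]
  ring

/-- Kernel ridge regression in the Hilbert space has a unique minimizer of
representer form. -/
theorem krr_hilbert_unique_minimizer
    {𝒳 H : Type*} [NormedAddCommGroup H] [InnerProductSpace ℝ H]
    (φ : 𝒳 → H) {n : ℕ} (X : Fin n → 𝒳)
    (K : Matrix (Fin n) (Fin n) ℝ) (hK : ∀ i j, K i j = ⟪φ (X i), φ (X j)⟫)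
    (lam : ℝ) (hlam : 0 < lam) (Y : Fin n → ℝ)
    (E : H → ℝ)
    (hE : ∀ w, E w = ∑ i, (Y i - ⟪w, φ (X i)⟫) ^ 2 + lam * ‖w‖ ^ 2)
    (αstar : Fin n → ℝ)
    (hα : αstar = (K + lam • (1 : Matrix (Fin n) (Fin n) ℝ))⁻¹.mulVec Y)
    (wstar : H) (hw : wstar = ∑ i, αstar i • φ (X i)) :
    (∀ w : H, E wstar ≤ E w) ∧ (∀ w : H, (∀ v : H, E w ≤ E v) → w = wstar) := by
  have hgram : K = Matrix.gram ℝ (fun i => φ (X i)) := Matrix.ext hK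
  have hres : ∀ i, Y i - ⟪wstar, φ (X i)⟫ = lam * αstar i := by
    intro i
    have hi := gram_add_smul_one_inv_mulVec_apply (fun i => φ (X i)) hlam Y i
    rw [← hgram, ← hα] at hi
    rw [hw, real_inner_comm, inner_sum, sub_eq_iff_eq_add', ← hi]
    simp only [real_inner_smul_right, mul_comm]
  have hexp : ∀ w, E w = E wstar + (∑ i, ⟪w - wstar, φ (X i)⟫ ^ 2 + lam * ‖w - wstar‖ ^ 2) := by
    intro w
    rw [hE, hE]
    exact regularized_least_squares_eq_add (fun i => φ (X i)) lam Y αstar hw hres w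
  have hsq : ∀ w, 0 ≤ ∑ i, ⟪w - wstar, φ (X i)⟫ ^ 2 := fun w =>
    Finset.sum_nonneg fun i _ => sq_nonneg _
  refine ⟨fun w => ?_, fun w hmin => ?_⟩
  · rw [hexp w]
    have := hsq w
    exact le_add_of_nonneg_right (by positivity)
  · have hle : lam * ‖w - wstar‖ ^ 2 ≤ 0 := by linarith [hmin wstar, hexp w, hsq w]
    have hzero : ‖w - wstar‖ ^ 2 = 0 :=
      le_antisymm (nonpos_of_mul_nonpos_right hle hlam) (sq_nonneg _)
    exact sub_eq_zero.mp (norm_eq_zero.mp (pow_eq_zero_iff two_ne_zero |>.mp hzero))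
end

section
/- Prediction function of kernel ridge regression: Let λ > 0, Y ∈ ℝⁿ, and let w* be the unique minimizer over H of E(w) = Σ_{i=1}^n (Y_i − ⟪w, φ(X_i)⟫)² + λ‖w‖². Then for every x ∈ 𝒳, the prediction satisfies f(x) := ⟪w*, φ(x)⟫ = Yᵀ (K + λ𝕀)^{-1} k(x), where k(x) = (k(X_1, x), …, k(X_n, x)) ∈ ℝⁿ is the kernel vector of x. -/
open scoped RealInnerProductSpace Matrix

namespace KernelRidge

variable {ι H : Type*} [Fintype ι] [NormedAddCommGroup H] [InnerProductSpace ℝ H]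

/-- The ridge regression objective for feature vectors `v` and targets `y`. -/
def objective (v : ι → H) (y : ι → ℝ) (c : ℝ) (w : H) : ℝ :=
  ∑ i, (y i - ⟪w, v i⟫) ^ 2 + c * ‖w‖ ^ 2

theorem objective_add (v : ι → H) (y : ι → ℝ) (c : ℝ) (w h : H) :
    objective v y c (w + h) = objective v y c w + (∑ i, ⟪h, v i⟫ ^ 2 + c * ‖h‖ ^ 2) +
      2 * (c * ⟪w, h⟫ - ∑ i, (y i - ⟪w, v i⟫) * ⟪h, v i⟫) := by
  have hsum : ∑ i, (y i - ⟪w + h, v i⟫) ^ 2 = ∑ i, (y i - ⟪w, v i⟫) ^ 2 +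
      ∑ i, ⟪h, v i⟫ ^ 2 - 2 * ∑ i, (y i - ⟪w, v i⟫) * ⟪h, v i⟫ := by
    rw [Finset.mul_sum, ← Finset.sum_add_distrib, ← Finset.sum_sub_distrib]
    refine Finset.sum_congr rfl fun i _ => ?_
    rw [inner_add_left]
    ring
  rw [objective, objective, hsum, norm_add_sq_real]
  ring

theorem objective_le_of_residual_eq {v : ι → H} {y : ι → ℝ} {c : ℝ} (hc : 0 ≤ c) {a : ι → ℝ}
    (ha : ∀ i, y i - ⟪∑ j, a j • v j, v i⟫ = c * a i) (w : H) :
    objective v y c (∑ j, a j • v j) ≤ objective v y c w := by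
  have hcross : c * ⟪∑ j, a j • v j, w - ∑ j, a j • v j⟫ -
      ∑ i, (y i - ⟪∑ j, a j • v j, v i⟫) * ⟪w - ∑ j, a j • v j, v i⟫ = 0 := by
    generalize w - ∑ j, a j • v j = h
    simp only [ha]
    rw [sum_inner, Finset.mul_sum, sub_eq_zero]
    refine Finset.sum_congr rfl fun i _ => ?_
    rw [real_inner_smul_left, real_inner_comm]
    ring
  have hadd := objective_add v y c (∑ j, a j • v j) (w - ∑ j, a j • v j)
  rw [hcross, add_sub_cancel] at hadd
  have hnonneg : 0 ≤ ∑ i, ⟪w - ∑ j, a j • v j, v i⟫ ^ 2 + c * ‖w - ∑ j, a j • v j‖ ^ 2 := by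
    positivity
  linarith

theorem posDef_gram_add_smul_one [DecidableEq ι] (v : ι → H) {c : ℝ} (hc : 0 < c) :
    (Matrix.gram ℝ v + c • (1 : Matrix ι ι ℝ)).PosDef :=
  Matrix.PosDef.posSemidef_add (Matrix.posSemidef_gram ℝ v) (Matrix.PosDef.one.smul hc)

theorem residual_gram_inv_mulVec [DecidableEq ι] (v : ι → H) (y : ι → ℝ) {c : ℝ} (hc : 0 < c)
    (i : ι) :
    y i - ⟪∑ j, ((Matrix.gram ℝ v + c • (1 : Matrix ι ι ℝ))⁻¹ *ᵥ y) j • v j, v i⟫ =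
      c * ((Matrix.gram ℝ v + c • (1 : Matrix ι ι ℝ))⁻¹ *ᵥ y) i := by
  have hdet := (Matrix.isUnit_iff_isUnit_det _).mp (posDef_gram_add_smul_one v hc).isUnit
  set a := (Matrix.gram ℝ v + c • (1 : Matrix ι ι ℝ))⁻¹ *ᵥ y with ha
  have hsolve : (Matrix.gram ℝ v + c • (1 : Matrix ι ι ℝ)) *ᵥ a = y := by
    rw [ha, Matrix.mulVec_mulVec, Matrix.mul_nonsing_inv _ hdet, Matrix.one_mulVec]
  have hinner : ⟪∑ j, a j • v j, v i⟫ = (Matrix.gram ℝ v *ᵥ a) i := by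
    simp only [sum_inner, real_inner_smul_left, Matrix.mulVec, dotProduct, Matrix.gram_apply]
    refine Finset.sum_congr rfl fun j _ => ?_
    rw [real_inner_comm, mul_comm]
  have hi := congrFun hsolve i
  rw [Matrix.add_mulVec, Matrix.smul_mulVec, Matrix.one_mulVec, Pi.add_apply, Pi.smul_apply,
    smul_eq_mul] at hi
  rw [hinner]
  linarith

end KernelRidge

/-- Prediction function of kernel ridge regression. -/
theorem krr_prediction_function
    {𝒳 H : Type*} [NormedAddCommGroup H] [InnerProductSpace ℝ H]
    (φ : 𝒳 → H) {n : ℕ} (X : Fin n → 𝒳)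
    (K : Matrix (Fin n) (Fin n) ℝ) (hK : ∀ i j, K i j = ⟪φ (X i), φ (X j)⟫)
    (lam : ℝ) (hlam : 0 < lam) (Y : Fin n → ℝ)
    (E : H → ℝ)
    (hE : ∀ w, E w = ∑ i, (Y i - ⟪w, φ (X i)⟫) ^ 2 + lam * ‖w‖ ^ 2)
    (wstar : H) (hmin : ∀ w : H, E wstar ≤ E w)
    (huniq : ∀ w : H, (∀ v : H, E w ≤ E v) → w = wstar) :
    ∀ x : 𝒳,
      ⟪wstar, φ x⟫ =
        Y ⬝ᵥ (K + lam • (1 : Matrix (Fin n) (Fin n) ℝ))⁻¹.mulVec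
          (fun i => ⟪φ (X i), φ x⟫) := by
  intro x
  obtain rfl : K = Matrix.gram ℝ (fun i => φ (X i)) := Matrix.ext hK
  obtain rfl : E = KernelRidge.objective (fun i => φ (X i)) Y lam := funext hE
  rw [← huniq _ (KernelRidge.objective_le_of_residual_eq hlam.le
    (KernelRidge.residual_gram_inv_mulVec (fun i => φ (X i)) Y hlam))]
  have hsymm := (KernelRidge.posDef_gram_add_smul_one (fun i => φ (X i)) hlam).isHermitian.inv
  rw [Matrix.IsHermitian, Matrix.conjTranspose_eq_transpose_of_trivial] at hsymm
  rw [Matrix.dotProduct_mulVec, ← Matrix.mulVec_transpose, hsymm, sum_inner]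
  exact Finset.sum_congr rfl fun i _ => real_inner_smul_left _ _ _
end
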